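/- arXiv:1804.05654 — 2 statements merged into one kernel-verified Lean document; each statement's English description precedes it below -/
import Mathlib

section
/- Assume there is a constant c₀ > 0 such that |c(v,v)| ≤ c₀·‖v‖_a·‖v‖_b for all v ∈ V, and assume β ≥ 2·c₀² + 1/2. Then A(v,v) ≥ (1/2)·|||v|||² for all v ∈ V; in particular the form A is coercive with respect to the energy seminorm on all of V. (Lemma 3.3, Coercivity, of the paper in abstract form, with the explicit choice γ = 1/(2c₀).) -/
/-- Coercivity (Lemma 3.3 of the paper, abstract form): for the least-squares
stabilized Nitsche form `A(v,w) = a(v,w) - c(v,w) - c(w,v) + β·b(v,w)`,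
if `|c(v,v)| ≤ c₀·‖v‖_a·‖v‖_b` and `β ≥ 2·c₀² + 1/2`, then
`A(v,v) ≥ (1/2)·|||v|||²` where `|||v|||² = ‖v‖_a² + ‖v‖_b²`. -/
theorem stabilized_nitsche_coercive
    {V : Type*} [AddCommGroup V] [Module ℝ V]
    (a b c : V →ₗ[ℝ] V →ₗ[ℝ] ℝ)
    (ha_symm : ∀ v w : V, a v w = a w v)
    (hb_symm : ∀ v w : V, b v w = b w v)
    (ha_pos : ∀ v : V, 0 ≤ a v v)
    (hb_pos : ∀ v : V, 0 ≤ b v v)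
    (β : ℝ) (c₀ : ℝ) (hc₀ : 0 < c₀)
    (hc : ∀ v : V, |c v v| ≤ c₀ * Real.sqrt (a v v) * Real.sqrt (b v v))
    (hβ : 2 * c₀ ^ 2 + 1 / 2 ≤ β) (v : V) :
    (1 / 2) * (Real.sqrt (a v v) ^ 2 + Real.sqrt (b v v) ^ 2)
      ≤ a v v - c v v - c v v + β * b v v := by
  have h1 := Real.sq_sqrt (ha_pos v)
  have h2 := Real.sq_sqrt (hb_pos v)
  have h3 := (le_abs_self _).trans (hc v)
  have h4 := mul_le_mul_of_nonneg_right hβ (hb_pos v)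
  have h5 := sq_nonneg (Real.sqrt (a v v) - 2 * c₀ * Real.sqrt (b v v))
  have h6 : (Real.sqrt (a v v) - 2 * c₀ * Real.sqrt (b v v)) ^ 2
      = a v v - 4 * (c₀ * Real.sqrt (a v v) * Real.sqrt (b v v)) + 4 * (c₀ ^ 2 * b v v) := by
    calc _ = Real.sqrt (a v v) ^ 2 - 4 * (c₀ * Real.sqrt (a v v) * Real.sqrt (b v v))
          + 4 * (c₀ ^ 2 * Real.sqrt (b v v) ^ 2) := by ring
      _ = _ := by rw [h1, h2]
  rw [h6] at h5
  rw [h1, h2]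
  linarith
end

section
/- Assume β ≥ 0 and that there is a constant c₀ ≥ 0 such that |c(v,w)| ≤ c₀·‖v‖_a·‖w‖_b for all v, w ∈ V. Then the form A is continuous with respect to the energy seminorm: for all v, w ∈ V, |A(v,w)| ≤ max(1, c₀)·max(2, 1+β)·|||v|||·|||w|||, where |||v||| = √(‖v‖_a² + ‖v‖_b²). (Lemma 3.5, Continuity, of the paper in abstract form; the Cauchy–Schwarz inequalities |a(v,w)| ≤ ‖v‖_a‖w‖_a and |b(v,w)| ≤ ‖v‖_b‖w‖_b follow from a and b being symmetric positive semidefinite.) -/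
/-- Cauchy–Schwarz for a symmetric positive semidefinite form. -/
lemma psd_abs_le {V : Type*} [AddCommGroup V] [Module ℝ V]
    (a : V →ₗ[ℝ] V →ₗ[ℝ] ℝ) (hs : ∀ v w : V, a v w = a w v)
    (hp : ∀ v : V, 0 ≤ a v v) (v w : V) :
    |a v w| ≤ Real.sqrt (a v v) * Real.sqrt (a w w) := by
  have h := LinearMap.BilinForm.apply_mul_apply_le_of_forall_zero_le a hp v w
  rw [← hs v w] at h
  rw [← Real.sqrt_mul (hp v)]
  apply Real.abs_le_sqrt
  nlinarith

lemma cs_two (p q r s : ℝ) :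
    p * r + q * s ≤ Real.sqrt (p ^ 2 + q ^ 2) * Real.sqrt (r ^ 2 + s ^ 2) := by
  rw [← Real.sqrt_mul (by positivity)]
  apply Real.le_sqrt_of_sq_le
  nlinarith [sq_nonneg (p * s - q * r)]



/-- Continuity (Lemma 3.5 of the paper, abstract form): for the least-squares
stabilized Nitsche form `A(v,w) = a(v,w) - c(v,w) - c(w,v) + β·b(v,w)`,
if `β ≥ 0` and `|c(v,w)| ≤ c₀·‖v‖_a·‖w‖_b`, then
`|A(v,w)| ≤ max(1,c₀)·max(2,1+β)·|||v|||·|||w|||` where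
`|||v||| = √(‖v‖_a² + ‖v‖_b²)`. -/
theorem stabilized_nitsche_continuity
    {V : Type*} [AddCommGroup V] [Module ℝ V]
    (a b c : V →ₗ[ℝ] V →ₗ[ℝ] ℝ)
    (ha_symm : ∀ v w : V, a v w = a w v)
    (hb_symm : ∀ v w : V, b v w = b w v)
    (ha_pos : ∀ v : V, 0 ≤ a v v)
    (hb_pos : ∀ v : V, 0 ≤ b v v)
    (β : ℝ) (hβ : 0 ≤ β) (c₀ : ℝ) (hc₀ : 0 ≤ c₀)
    (hc : ∀ v w : V, |c v w| ≤ c₀ * Real.sqrt (a v v) * Real.sqrt (b w w))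
    (v w : V) :
    |a v w - c v w - c w v + β * b v w|
      ≤ max 1 c₀ * max 2 (1 + β) *
          Real.sqrt (Real.sqrt (a v v) ^ 2 + Real.sqrt (b v v) ^ 2) *
          Real.sqrt (Real.sqrt (a w w) ^ 2 + Real.sqrt (b w w) ^ 2) := by
  have h1 := psd_abs_le a ha_symm ha_pos v w
  have h2 := psd_abs_le b hb_symm hb_pos v w
  have h3 := hc v w
  have h4 := hc w v
  have hp := Real.sqrt_nonneg (a v v)
  have hq := Real.sqrt_nonneg (b v v)
  have hr := Real.sqrt_nonneg (a w w)
  have hs := Real.sqrt_nonneg (b w w)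
  generalize Real.sqrt (a v v) = p at *
  generalize Real.sqrt (b v v) = q at *
  generalize Real.sqrt (a w w) = r at *
  generalize Real.sqrt (b w w) = s at *
  have e1 := cs_two p q r s
  have e2 := cs_two p q s r
  rw [add_comm (s ^ 2) (r ^ 2)] at e2
  rw [mul_assoc _ (Real.sqrt (p ^ 2 + q ^ 2))]
  generalize Real.sqrt (p ^ 2 + q ^ 2) * Real.sqrt (r ^ 2 + s ^ 2) = E at *
  have hM1 : 1 ≤ max 1 c₀ := le_max_left _ _
  have hM2 : c₀ ≤ max 1 c₀ := le_max_right _ _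
  have hK1 : 2 ≤ max 2 (1 + β) := le_max_left _ _
  have hK2 : 1 + β ≤ max 2 (1 + β) := le_max_right _ _
  generalize max 1 c₀ = M at *
  generalize max 2 (1 + β) = K at *
  have hpr := mul_nonneg hp hr
  have hps := mul_nonneg hp hs
  have hqr := mul_nonneg hq hr
  have hqs := mul_nonneg hq hs
  have f1 : p * r + p * s + q * r + β * (q * s) ≤ K * E := by
    have g1 : 0 ≤ (K - 2) * (p * r) := mul_nonneg (by linarith) hpr
    have g2 : 0 ≤ (K - 1 - β) * (q * s) := mul_nonneg (by linarith) hqs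
    have g3 : 0 ≤ (K - 1) * (E - (p * r + q * s)) := mul_nonneg (by linarith) (by linarith)
    linarith
  have f2 : |a v w - c v w - c w v + β * b v w|
      ≤ |a v w| + |c v w| + |c w v| + β * |b v w| := by
    have t1 := abs_add_le (a v w - c v w - c w v) (β * b v w)
    have t2 := abs_sub (a v w - c v w) (c w v)
    have t3 := abs_sub (a v w) (c v w)
    rw [abs_mul, abs_of_nonneg hβ] at t1
    linarith
  have f3 : β * |b v w| ≤ β * (q * s) := mul_le_mul_of_nonneg_left h2 hβ
  have k1 : 0 ≤ (M - 1) * (p * r) := mul_nonneg (by linarith) hpr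
  have k2 : 0 ≤ (M - c₀) * (p * s) := mul_nonneg (by linarith) hps
  have k3 : 0 ≤ (M - c₀) * (q * r) := mul_nonneg (by linarith) hqr
  have k4 : 0 ≤ (M - 1) * (β * (q * s)) := mul_nonneg (by linarith) (mul_nonneg hβ hqs)
  have k5 : 0 ≤ M * (K * E - (p * r + p * s + q * r + β * (q * s))) :=
    mul_nonneg (by linarith) (by linarith)
  linarith
end
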